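/- Let F be a field and let f ∈ F⟦z⟧ be a formal power series with nonzero constant term (so that f is invertible in F⟦z⟧). For every integer n ≥ 1, the Hasse–Teichmüller derivative satisfies H^(n)(1/f) = ∑_{k=1}^{n} binom(n+1, k+1) (-1)^k / f^{k+1} · ∑_{i_1,…,i_k ≥ 0, i_1+⋯+i_k = n} H^(i_1)(f) ⋯ H^(i_k)(f), where the inner sum is over all ordered k-tuples of nonnegative integers summing to n. -/

import Mathlib

noncomputable section

/-- The Hasse–Teichmüller derivative `H^(n)` of order `n` on `F⟦z⟧`: the `m`-th coefficient of
`H^(n) f` is `C(m+n, n)` times the `(m+n)`-th coefficient of `f`. -/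
def hasseTeich (F : Type*) [Field F] (n : ℕ) (f : PowerSeries F) : PowerSeries F :=
  PowerSeries.mk fun m : ℕ => ((m + n).choose n : F) * PowerSeries.coeff (m + n) f

lemma hT_X (F : Type*) [Field F] (i : ℕ) (f : PowerSeries F) :
    PowerSeries.X ^ i * hasseTeich F i f
      = PowerSeries.mk fun a => (a.choose i : F) * PowerSeries.coeff a f := by
  ext a
  rw [PowerSeries.coeff_X_pow_mul', PowerSeries.coeff_mk]
  split_ifs with h
  · rw [hasseTeich, PowerSeries.coeff_mk, Nat.sub_add_cancel h]
  · rw [Nat.choose_eq_zero_of_lt (by omega)]; simp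

lemma hT_mul (F : Type*) [Field F] (n : ℕ) (f g : PowerSeries F) :
    hasseTeich F n (f * g)
      = ∑ p ∈ Finset.HasAntidiagonal.antidiagonal n, hasseTeich F p.1 f * hasseTeich F p.2 g := by
  have hX : (PowerSeries.X : PowerSeries F) ^ n ≠ 0 := pow_ne_zero _ PowerSeries.X_ne_zero
  apply mul_left_cancel₀ hX
  rw [hT_X, Finset.mul_sum]
  have : ∀ p ∈ Finset.HasAntidiagonal.antidiagonal n,
      (PowerSeries.X : PowerSeries F) ^ n * (hasseTeich F p.1 f * hasseTeich F p.2 g)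
      = (PowerSeries.mk fun a => (a.choose p.1 : F) * PowerSeries.coeff a f) *
        (PowerSeries.mk fun a => (a.choose p.2 : F) * PowerSeries.coeff a g) := by
    intro p hp
    rw [← hT_X, ← hT_X, ← Finset.HasAntidiagonal.mem_antidiagonal.1 hp]
    ring
  rw [Finset.sum_congr rfl this]
  ext a
  simp only [map_sum, PowerSeries.coeff_mk, PowerSeries.coeff_mul]
  rw [Finset.sum_comm, Finset.mul_sum]
  refine Finset.sum_congr rfl fun q hq => ?_
  rw [← Finset.HasAntidiagonal.mem_antidiagonal.1 hq, Nat.add_choose_eq]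
  push_cast
  rw [Finset.sum_mul]
  exact Finset.sum_congr rfl fun p _ => by ring

/-- The generating series. -/
def hTgen (F : Type*) [Field F] (f : PowerSeries F) : PowerSeries (PowerSeries F) :=
  PowerSeries.mk fun n => hasseTeich F n f

lemma hTgen_mul (F : Type*) [Field F] (f g : PowerSeries F) :
    hTgen F (f * g) = hTgen F f * hTgen F g := by
  ext1 n
  simp only [hTgen, PowerSeries.coeff_mk, PowerSeries.coeff_mul, hT_mul]

lemma hTgen_one (F : Type*) [Field F] : hTgen F 1 = 1 := by
  ext n m
  simp only [hTgen, hasseTeich, PowerSeries.coeff_mk, PowerSeries.coeff_one]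
  by_cases hn : n = 0
  · subst hn; simp [PowerSeries.coeff_one]
  · simp [hn]

lemma coeff_pow_tuple {R : Type*} [CommRing R] (h : ℕ → R) (k n : ℕ) :
    PowerSeries.coeff n ((PowerSeries.mk h) ^ k)
      = ∑ i ∈ Finset.Nat.antidiagonalTuple k n, ∏ j, h (i j) := by
  have : (PowerSeries.mk h) ^ k = ∏ _j : Fin k, PowerSeries.mk h := by simp
  rw [this, PowerSeries.coeff_prod]
  refine Finset.sum_bij' (fun l _ => (l : Fin k → ℕ)) (fun i _ => Finsupp.equivFunOnFinite.symm i)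
    ?_ ?_ ?_ ?_ ?_
  · intro l hl
    simpa [Finset.Nat.mem_antidiagonalTuple, Finset.mem_finsuppAntidiag] using hl
  · intro l hl
    simpa [Finset.Nat.mem_antidiagonalTuple, Finset.mem_finsuppAntidiag] using hl
  · intro l hl; ext; simp
  · intro l hl; ext; simp
  · intro l hl; simp

lemma key {R : Type*} [CommRing R] (u E : PowerSeries R) (hu : PowerSeries.constantCoeff u = 1)
    (h : u * E = 1) (n : ℕ) (hn : 1 ≤ n) :
    PowerSeries.coeff n E
      = ∑ k ∈ Finset.Icc 1 n, ((n + 1).choose (k + 1) : R) * (-1) ^ k *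
          PowerSeries.coeff n (u ^ k) := by
  have h0 : PowerSeries.coeff n ((-u + 1) ^ (n + 1) * E) = 0 := by
    have hd : (PowerSeries.X : PowerSeries R) ∣ (-u + 1) := by
      rw [PowerSeries.X_dvd_iff]; simp [hu]
    have := (pow_dvd_pow_of_dvd hd (n + 1)).mul_right E
    exact PowerSeries.X_pow_dvd_iff.1 this n (by omega)
  rw [add_pow, Finset.sum_range_succ', add_mul, Finset.sum_mul] at h0
  have h1 : ∀ k ∈ Finset.range (n + 1),
      (-u) ^ (k + 1) * 1 ^ (n + 1 - (k + 1)) * ((n + 1).choose (k + 1) : PowerSeries R) * E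
      = -(PowerSeries.C (((n + 1).choose (k + 1) : R) * (-1) ^ k) * u ^ k) := by
    intro k _
    have : (-u) ^ (k + 1) * 1 ^ (n + 1 - (k + 1)) * ((n + 1).choose (k + 1) : PowerSeries R) * E
      = (-1) ^ (k + 1) * u ^ k * ((n + 1).choose (k + 1) : PowerSeries R) * (u * E) := by
      rw [neg_pow, one_pow]; ring
    rw [this, h]
    simp only [map_mul, map_pow, map_neg, map_one, map_natCast]
    ring
  rw [Finset.sum_congr rfl h1] at h0
  simp only [map_add, map_sum, map_neg, PowerSeries.coeff_C_mul, Finset.sum_neg_distrib] at h0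
  have h2 : ∑ k ∈ Finset.range (n + 1), ((n + 1).choose (k + 1) : R) * (-1) ^ k *
          PowerSeries.coeff n (u ^ k) = ∑ k ∈ Finset.Icc 1 n, ((n + 1).choose (k + 1) : R) *
          (-1) ^ k * PowerSeries.coeff n (u ^ k) := by
    symm
    apply Finset.sum_subset
    · intro k hk; rw [Finset.mem_Icc] at hk; rw [Finset.mem_range]; omega
    · intro k hk hk'
      have : k = 0 := by simp at hk hk'; omega
      subst this
      simp [PowerSeries.coeff_one, show n ≠ 0 by omega]
  rw [h2] at h0
  simp at h0
  linear_combination h0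

/-- Quotient rule:
`H^(n)(1/f) = ∑_{k=1}^n C(n+1,k+1) (-1)^k / f^{k+1}
  ∑_{i_1+⋯+i_k=n, i_j ≥ 0} H^(i_1)(f) ⋯ H^(i_k)(f)`. -/
theorem hasseTeich_inv' (F : Type*) [Field F] (f : PowerSeries F)
    (hf : PowerSeries.constantCoeff f ≠ 0) (n : ℕ) (hn : 1 ≤ n) :
    hasseTeich F n f⁻¹
      = ∑ k ∈ Finset.Icc 1 n,
          ((n + 1).choose (k + 1) : PowerSeries F) * (-1) ^ k * (f ^ (k + 1))⁻¹ *
            ∑ i ∈ Finset.Nat.antidiagonalTuple k n, ∏ j, hasseTeich F (i j) f := by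
  have hff : f * f⁻¹ = 1 := PowerSeries.mul_inv_cancel f hf
  have hinv : ∀ k, (f ^ k)⁻¹ = f⁻¹ ^ k := by
    intro k
    have h1 : f ^ k * (f ^ k)⁻¹ = 1 := PowerSeries.mul_inv_cancel _ (by simpa using fun h => absurd h hf)
    have h2 : f ^ k * f⁻¹ ^ k = 1 := by rw [← mul_pow, hff, one_pow]
    calc (f ^ k)⁻¹ = (f ^ k * f⁻¹ ^ k) * (f ^ k)⁻¹ := by rw [h2, one_mul]
      _ = (f ^ k * (f ^ k)⁻¹) * f⁻¹ ^ k := by ring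
      _ = _ := by rw [h1, one_mul]
  have hG : hTgen F f * hTgen F f⁻¹ = 1 := by rw [← hTgen_mul, hff, hTgen_one]
  have hC : PowerSeries.C f⁻¹ * PowerSeries.C f = (1 : PowerSeries (PowerSeries F)) := by
    rw [← map_mul, mul_comm, hff, map_one]
  have hk := key (PowerSeries.C f⁻¹ * hTgen F f) (PowerSeries.C f * hTgen F f⁻¹) (by
      have : hasseTeich F 0 f = f := by ext m; simp [hasseTeich]
      simp only [map_mul, PowerSeries.constantCoeff_C]
      rw [← PowerSeries.coeff_zero_eq_constantCoeff_apply, hTgen, PowerSeries.coeff_mk, this,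
        mul_comm, hff]) (by
      rw [mul_mul_mul_comm, hC, hG, one_mul]) n hn
  rw [PowerSeries.coeff_C_mul] at hk
  have hl : PowerSeries.coeff n (hTgen F f⁻¹) = hasseTeich F n f⁻¹ := by simp [hTgen]
  rw [hl] at hk
  calc hasseTeich F n f⁻¹ = f⁻¹ * (f * hasseTeich F n f⁻¹) := by
        rw [← mul_assoc, mul_comm f⁻¹, hff, one_mul]
    _ = _ := by
        rw [hk, Finset.mul_sum]
        refine Finset.sum_congr rfl fun k _ => ?_
        rw [hinv, mul_pow, ← map_pow, PowerSeries.coeff_C_mul, hTgen, coeff_pow_tuple]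
        ring

end
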